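/- arXiv:1601.06707 — 2 statements merged into one kernel-verified Lean document; each statement's English description precedes it below -/
import Mathlib

section
/- Assume conditions (C1)–(C3). Then the formula L₁u(t) := ∫_a^b k⁺(t,s)g(s)u(s)ds, where k⁺ denotes the positive part of k, defines a bounded linear operator L₁ : C(I) → C(I), and its spectral radius satisfies r(L₁) ≥ (c₁/2)·∫_a^b Φ(s)g(s)ds > 0. -/
open MeasureTheory Set Filter Topology

noncomputable section

/-- The unit interval `[0,1]` as a subset of `ℝ`. -/
abbrev unitI : Set ℝ := Set.Icc 0 1

/-- The Banach space `C(I)` of continuous real functions on `[0,1]` with the sup norm. -/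
abbrev CI := C(unitI, ℝ)

/-- Lebesgue measure restricted to `[0,1]`. -/
def μ01 : Measure ℝ := MeasureTheory.volume.restrict unitI

/-- Evaluation of `u ∈ C(I)` at a real number, via projection onto `[0,1]`. -/
def ev (u : CI) (s : ℝ) : ℝ := u (Set.projIcc 0 1 zero_le_one s)

theorem continuous_ev (u : CI) : Continuous (ev u) :=
  u.continuous.comp continuous_projIcc

theorem norm_ev_le (u : CI) (s : ℝ) : ‖ev u s‖ ≤ ‖u‖ :=
  u.norm_coe_le_norm _

/-- If `‖xⁿ‖ ≥ lⁿ` for all `n`, with `l > 0`, then `‖xⁿ‖^{1/n}` converges to a limit `≥ l`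
(Fekete's lemma for `log ‖xⁿ‖`). -/
theorem exists_tendsto_norm_pow_rpow {A : Type*} [SeminormedRing A] (x : A) {l : ℝ} (hl : 0 < l)
    (h : ∀ n : ℕ, l ^ n ≤ ‖x ^ n‖) :
    ∃ r, Tendsto (fun n : ℕ => ‖x ^ n‖ ^ ((1 : ℝ) / n)) atTop (𝓝 r) ∧ l ≤ r := by
  have hpos : ∀ n : ℕ, 0 < ‖x ^ n‖ := fun n => (pow_pos hl n).trans_le (h n)
  have hsub : Subadditive fun n : ℕ => Real.log ‖x ^ n‖ := fun m n => by
    rw [← Real.log_mul (hpos m).ne' (hpos n).ne']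
    exact Real.log_le_log (hpos _) (by simpa only [pow_add] using norm_mul_le (x ^ m) (x ^ n))
  have hlog : ∀ n : ℕ, n * Real.log l ≤ Real.log ‖x ^ n‖ := fun n => by
    rw [← Real.log_pow]
    exact Real.log_le_log (pow_pos hl n) (h n)
  have hdiv : ∀ n : ℕ, n ≠ 0 → Real.log l ≤ Real.log ‖x ^ n‖ / n := fun n hn => by
    rw [le_div_iff₀ (by positivity), mul_comm]
    exact hlog n
  have hbdd : BddBelow (range fun n : ℕ => Real.log ‖x ^ n‖ / n) := by
    refine ⟨min 0 (Real.log l), ?_⟩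
    rintro _ ⟨n, rfl⟩
    rcases eq_or_ne n 0 with rfl | hn
    · simp
    · exact (min_le_right _ _).trans (hdiv n hn)
  have hlim := hsub.tendsto_lim hbdd
  refine ⟨Real.exp hsub.lim, ?_, ?_⟩
  · refine ((Real.continuous_exp.tendsto _).comp hlim).congr fun n => ?_
    rw [Function.comp_apply, Real.rpow_def_of_pos (hpos n), mul_one_div]
  · rw [← Real.exp_log hl, Real.exp_le_exp]
    refine ge_of_tendsto hlim ?_
    filter_upwards [eventually_ne_atTop 0] with n hn using hdiv n hn

section IntegralOperator

variable {μ : Measure ℝ} {K : unitI → ℝ → ℝ} {B : ℝ → ℝ}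

theorem integrable_kernel_mul_ev (hK : ∀ t, Integrable (K t) μ) (u : CI) (t : unitI) :
    Integrable (fun s => K t s * ev u s) μ :=
  (hK t).mul_bdd (c := ‖u‖) (continuous_ev u).aestronglyMeasurable
    (Eventually.of_forall (norm_ev_le u))

/-- A dominated kernel that is continuous in its first variable defines a bounded integral
operator on `C(I)`. -/
theorem exists_integralOperator (hK : ∀ t, Integrable (K t) μ)
    (hcont : ∀ τ, ∀ᵐ s ∂μ, Tendsto (fun t => K t s) (𝓝 τ) (𝓝 (K τ s)))
    (hB : Integrable B μ) (hKB : ∀ t, ∀ᵐ s ∂μ, ‖K t s‖ ≤ B s) :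
    ∃ L : CI →L[ℝ] CI, ∀ u t, L u t = ∫ s, K t s * ev u s ∂μ := by
  have hint := integrable_kernel_mul_ev hK
  have hle : ∀ (u : CI) (t : unitI), ∀ᵐ s ∂μ, ‖K t s * ev u s‖ ≤ B s * ‖u‖ := fun u t => by
    filter_upwards [hKB t] with s hs
    rw [norm_mul]
    exact mul_le_mul hs (norm_ev_le u s) (norm_nonneg _) ((norm_nonneg _).trans hs)
  have hcontinuous : ∀ u : CI, Continuous fun t => ∫ s, K t s * ev u s ∂μ := fun u => by
    refine continuous_iff_continuousAt.2 fun τ => ?_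
    refine tendsto_integral_filter_of_dominated_convergence (fun s => B s * ‖u‖)
      (Eventually.of_forall fun t => (hint u t).aestronglyMeasurable)
      (Eventually.of_forall (hle u)) (hB.mul_const _) ?_
    filter_upwards [hcont τ] with s hs using hs.mul_const _
  refine ⟨LinearMap.mkContinuous
    { toFun := fun u => ⟨fun t => ∫ s, K t s * ev u s ∂μ, hcontinuous u⟩
      map_add' := fun u v => ?_
      map_smul' := fun c u => ?_ } (∫ s, B s ∂μ) fun u => ?_, fun u t => rfl⟩
  · ext t
    simp only [ContinuousMap.coe_mk, ContinuousMap.add_apply]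
    rw [← integral_add (hint u t) (hint v t)]
    exact integral_congr_ae (Eventually.of_forall fun s => mul_add _ _ _)
  · ext t
    simp only [ContinuousMap.coe_mk, ContinuousMap.smul_apply, RingHom.id_apply, smul_eq_mul]
    rw [← integral_const_mul]
    exact integral_congr_ae (Eventually.of_forall fun s => mul_left_comm _ _ _)
  · have hB0 : 0 ≤ ∫ s, B s ∂μ := integral_nonneg_of_ae <| by
      filter_upwards [hKB 0] with s hs using (norm_nonneg _).trans hs
    refine (ContinuousMap.norm_le _ (mul_nonneg hB0 (norm_nonneg _))).2 fun t => ?_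
    rw [← integral_mul_const]
    exact norm_integral_le_of_norm_le (hB.mul_const _) (hle u t)

/-- If the kernel dominates `f ≥ 0` for all `t` in a set `S` carrying the measure, the iterates of
the integral operator on the constant function `1` are at least `(∫ f)ⁿ` on `S`. -/
theorem integral_pow_le_pow_apply_one {L : CI →L[ℝ] CI}
    (hL : ∀ u t, L u t = ∫ s, K t s * ev u s ∂μ) (hK : ∀ t, Integrable (K t) μ)
    {S : Set unitI} (hS : ∀ᵐ s ∂μ, projIcc 0 1 zero_le_one s ∈ S)
    {f : ℝ → ℝ} (hf : Integrable f μ) (hf0 : 0 ≤ᵐ[μ] f) (hfK : ∀ t ∈ S, f ≤ᵐ[μ] K t)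
    (n : ℕ) : ∀ t ∈ S, (∫ s, f s ∂μ) ^ n ≤ (L ^ n) 1 t := by
  induction n with
  | zero => intro t _; simp
  | succ n ih =>
    intro t ht
    rw [pow_succ' L, mul_apply_eq_comp, hL, pow_succ', ← integral_mul_const]
    refine integral_mono_ae (hf.mul_const _) (integrable_kernel_mul_ev hK _ t) ?_
    filter_upwards [hS, hf0, hfK t ht] with s hs h0 hfs
    exact mul_le_mul hfs (ih _ hs) (pow_nonneg (integral_nonneg_of_ae hf0) n) (h0.trans hfs)

end IntegralOperator

/-- Under (C1)–(C3), `L₁u(t) = ∫_a^b k⁺(t,s)g(s)u(s)ds` defines a bounded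
linear operator on `C(I)` whose spectral radius `r(L₁) = lim ‖L₁ⁿ‖^{1/n}` satisfies
`r(L₁) ≥ (c₁/2)∫_a^b Φ(s)g(s)ds > 0`. -/
theorem statement14
    (k : ℝ → ℝ → ℝ) (g Φ : ℝ → ℝ) (a b c₁ : ℝ)
    -- (C1)
    (hC1meas : Measurable (Function.uncurry k))
    (hC1cont : ∀ τ : unitI, ∀ᵐ s ∂μ01,
      Tendsto (fun t : unitI => |k ↑t s - k ↑τ s|) (𝓝 τ) (𝓝 0))
    -- (C2)
    (hc₁0 : 0 < c₁) (hc₁1 : c₁ ≤ 1)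
    (hΦint : IntegrableOn Φ unitI)
    (hkup : ∀ t : unitI, ∀ᵐ s ∂μ01, |k ↑t s| ≤ Φ s)
    (hklow : ∀ t : unitI, (t : ℝ) ∈ Set.Icc a b → ∀ᵐ s ∂μ01, c₁ * Φ s ≤ k ↑t s)
    -- (C3)
    (ha : 0 ≤ a) (hb : b ≤ 1) (hab : a ≤ b)
    (hgmeas : Measurable g) (hgint : IntegrableOn g unitI)
    (hgΦint : IntegrableOn (fun s => g s * Φ s) unitI)
    (hgpos : ∀ᵐ s ∂μ01, 0 ≤ g s)
    (hΦgpos : 0 < ∫ s in Set.Icc a b, Φ s * g s) :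
    ∃ (L₁ : CI →L[ℝ] CI) (r : ℝ),
      (∀ (u : CI) (t : unitI),
        L₁ u t = ∫ s in Set.Icc a b, max (k ↑t s) 0 * g s * ev u s) ∧
      Tendsto (fun n : ℕ => ‖L₁ ^ n‖ ^ ((1 : ℝ) / n)) atTop (𝓝 r) ∧
      c₁ / 2 * (∫ s in Set.Icc a b, Φ s * g s) ≤ r ∧
      0 < c₁ / 2 * ∫ s in Set.Icc a b, Φ s * g s := by
  have hsub : Icc a b ⊆ unitI := Icc_subset_Icc ha hb
  have hae : ∀ {p : ℝ → Prop}, (∀ᵐ s ∂μ01, p s) → ∀ᵐ s ∂volume.restrict (Icc a b), p s :=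
    fun h => ae_restrict_of_ae_restrict_of_subset hsub h
  have hΦg : IntegrableOn (fun s => Φ s * g s) (Icc a b) := by
    simpa only [mul_comm] using hgΦint.mono_set hsub
  have hKB : ∀ t : unitI, ∀ᵐ s ∂volume.restrict (Icc a b),
      ‖max (k t s) 0 * g s‖ ≤ Φ s * g s := fun t => by
    filter_upwards [hae (hkup t), hae hgpos] with s hs hg
    rw [norm_mul, Real.norm_of_nonneg hg, Real.norm_of_nonneg (le_max_right _ _)]
    exact mul_le_mul_of_nonneg_right
      (max_le ((le_abs_self _).trans hs) ((abs_nonneg _).trans hs)) hg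
  have hK : ∀ t : unitI,
      Integrable (fun s => max (k t s) 0 * g s) (volume.restrict (Icc a b)) := fun t =>
    hΦg.mono' (((hC1meas.of_uncurry_left.max measurable_const).mul
      hgmeas).aestronglyMeasurable) (hKB t)
  have hcont : ∀ τ : unitI, ∀ᵐ s ∂volume.restrict (Icc a b),
      Tendsto (fun t : unitI => max (k t s) 0 * g s) (𝓝 τ) (𝓝 (max (k τ s) 0 * g s)) :=
    fun τ => by
      filter_upwards [hae (hC1cont τ)] with s hs
      have hk : Tendsto (fun t : unitI => k t s) (𝓝 τ) (𝓝 (k τ s)) :=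
        tendsto_iff_norm_sub_tendsto_zero.2 hs
      exact (hk.max tendsto_const_nhds).mul_const _
  obtain ⟨L, hL⟩ := exists_integralOperator hK hcont hΦg hKB
  set J := ∫ s in Icc a b, Φ s * g s with hJ
  have hlower : ∀ n : ℕ, (c₁ * J) ^ n ≤ ‖L ^ n‖ := fun n => by
    have haI : a ∈ unitI := hsub (left_mem_Icc.2 hab)
    have hpow := integral_pow_le_pow_apply_one hL hK
      (S := {t : unitI | (t : ℝ) ∈ Icc a b}) (f := fun s => c₁ * (Φ s * g s))
      (by
        filter_upwards [ae_restrict_mem measurableSet_Icc] with s hs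
        rw [projIcc_of_mem zero_le_one (hsub hs)]
        exact hs)
      (hΦg.const_mul _)
      (by
        filter_upwards [hae (hkup ⟨a, haI⟩), hae hgpos] with s hs hg
        exact mul_nonneg hc₁0.le (mul_nonneg ((abs_nonneg _).trans hs) hg))
      (fun t ht => by
        filter_upwards [hae (hklow t ht), hae hgpos] with s hs hg
        rw [← mul_assoc]
        exact mul_le_mul_of_nonneg_right (hs.trans (le_max_left _ _)) hg)
      n ⟨a, haI⟩ (left_mem_Icc.2 hab)
    rw [integral_const_mul] at hpow
    calc (c₁ * J) ^ n ≤ (L ^ n) 1 ⟨a, haI⟩ := hpow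
      _ ≤ ‖(L ^ n) 1‖ := (le_abs_self _).trans (((L ^ n) 1).norm_coe_le_norm ⟨a, haI⟩)
      _ ≤ ‖L ^ n‖ * ‖(1 : CI)‖ := (L ^ n).le_opNorm _
      _ = ‖L ^ n‖ := by rw [norm_one, mul_one]
  have hpos : 0 < c₁ * J := mul_pos hc₁0 hΦgpos
  obtain ⟨r, hr, hle⟩ := exists_tendsto_norm_pow_rpow L hpos hlower
  exact ⟨L, r, hL, hr, by linarith, by linarith⟩
end
end

section
/- Assume conditions (C1)–(C3), and define the bounded linear operator L̄ : C[a,b] → C[a,b] by L̄u(t) := ∫_a^b k⁺(t,s)g(s)u(s)ds, where k⁺ is the positive part of k. Suppose u∈C[a,b] satisfies u(t) > 0 for every t∈[a,b], and λ>0 is such that λu(t) ≥ L̄u(t) for all t∈[a,b]. Then the spectral radius of L̄ satisfies r(L̄) ≤ λ. -/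
open MeasureTheory Set Filter Topology

noncomputable section

/-- Powers of a positive operator on `C(X, ℝ)` that sends the strictly positive function `u` below
`c • u` grow at most like `c ^ n`. -/
theorem exists_norm_pow_le_mul_pow_of_apply_le {X : Type*} [TopologicalSpace X] [CompactSpace X]
    [Nonempty X] (T : C(X, ℝ) →L[ℝ] C(X, ℝ)) (hT : ∀ w : C(X, ℝ), 0 ≤ w → 0 ≤ T w)
    (u : C(X, ℝ)) (hu : ∀ x, 0 < u x) {c : ℝ} (hc : 0 ≤ c) (hTu : T u ≤ c • u) :
    ∃ C : ℝ, 0 < C ∧ ∀ n : ℕ, ‖T ^ n‖ ≤ C * c ^ n := by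
  obtain ⟨x₀, -, hx₀⟩ := isCompact_univ.exists_isMinOn univ_nonempty u.continuous.continuousOn
  have hmin : ∀ x, u x₀ ≤ u x := fun x => hx₀ (mem_univ x)
  have hm := hu x₀
  have hu_norm : 0 < ‖u‖ := hm.trans_le ((le_abs_self _).trans (u.norm_coe_le_norm x₀))
  have hpow_nonneg : ∀ (n : ℕ) (w : C(X, ℝ)), 0 ≤ w → 0 ≤ (T ^ n) w := by
    intro n
    induction n with
    | zero => intro w hw; simpa using hw
    | succ n ih => intro w hw; rw [pow_succ]; exact ih _ (hT w hw)
  have hpow_mono : ∀ (n : ℕ) (v w : C(X, ℝ)), v ≤ w → (T ^ n) v ≤ (T ^ n) w := by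
    intro n v w hvw
    have := hpow_nonneg n (w - v) (sub_nonneg.2 hvw)
    rwa [map_sub, sub_nonneg] at this
  have hpow_u : ∀ (n : ℕ) (x : X), (T ^ n) u x ≤ c ^ n * u x := by
    intro n
    induction n with
    | zero => intro x; simp
    | succ n ih =>
      intro x
      have h₁ : (T ^ n) (T u) x ≤ (T ^ n) (c • u) x := hpow_mono n _ _ hTu x
      rw [map_smul] at h₁
      calc (T ^ (n + 1)) u x = (T ^ n) (T u) x := by rw [pow_succ]; rfl
        _ ≤ c * (T ^ n) u x := h₁
        _ ≤ c * (c ^ n * u x) := mul_le_mul_of_nonneg_left (ih x) hc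
        _ = c ^ (n + 1) * u x := by ring
  refine ⟨‖u‖ / u x₀, div_pos hu_norm hm, fun n => ?_⟩
  refine ContinuousLinearMap.opNorm_le_bound _ (by positivity) fun v => ?_
  rw [ContinuousMap.norm_le _ (by positivity)]
  intro x
  set d := ‖v‖ / u x₀ with hd
  have hd0 : 0 ≤ d := by positivity
  have hvd : ∀ y, |v y| ≤ d * u y := by
    intro y
    calc |v y| ≤ ‖v‖ := v.norm_coe_le_norm y
      _ = d * u x₀ := by rw [hd]; field_simp
      _ ≤ d * u y := mul_le_mul_of_nonneg_left (hmin y) hd0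
  have hupper : (T ^ n) v x ≤ (T ^ n) (d • u) x :=
    hpow_mono n v (d • u) (fun y => (abs_le.1 (hvd y)).2) x
  have hlower : (T ^ n) (-(d • u)) x ≤ (T ^ n) v x :=
    hpow_mono n (-(d • u)) v (fun y => (abs_le.1 (hvd y)).1) x
  rw [map_neg, map_smul] at hlower
  rw [map_smul] at hupper
  have habs : |(T ^ n) v x| ≤ d * (T ^ n) u x := abs_le.2 ⟨hlower, hupper⟩
  have hux : u x ≤ ‖u‖ := (le_abs_self _).trans (u.norm_coe_le_norm x)
  calc ‖(T ^ n) v x‖ ≤ d * (T ^ n) u x := habs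
    _ ≤ d * (c ^ n * ‖u‖) := by
      refine mul_le_mul_of_nonneg_left ((hpow_u n x).trans ?_) hd0
      exact mul_le_mul_of_nonneg_left hux (pow_nonneg hc n)
    _ = ‖u‖ / u x₀ * c ^ n * ‖v‖ := by rw [hd]; ring

/-- If `x n ≤ C * c ^ n` for all `n`, then a limit of the `n`-th roots of `x n` is at most `c`. -/
theorem le_of_tendsto_rpow_one_div_of_le_mul_pow {x : ℕ → ℝ} {C c r : ℝ} (hx : ∀ n, 0 ≤ x n)
    (hC : 0 < C) (hc : 0 ≤ c) (hle : ∀ n, x n ≤ C * c ^ n)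
    (hr : Tendsto (fun n : ℕ => x n ^ ((1 : ℝ) / n)) atTop (𝓝 r)) : r ≤ c := by
  have hroot : Tendsto (fun n : ℕ => C ^ ((1 : ℝ) / n) * c) atTop (𝓝 c) := by
    have h := Tendsto.rpow (tendsto_const_nhds (x := C))
      (tendsto_one_div_atTop_nhds_zero_nat (𝕜 := ℝ)) (Or.inl hC.ne')
    simpa using h.mul_const c
  refine le_of_tendsto_of_tendsto hr hroot ?_
  filter_upwards [eventually_ne_atTop 0] with n hn
  calc x n ^ ((1 : ℝ) / n) ≤ (C * c ^ n) ^ ((1 : ℝ) / n) :=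
        Real.rpow_le_rpow (hx n) (hle n) (by positivity)
    _ = C ^ ((1 : ℝ) / n) * c := by
      rw [Real.mul_rpow hC.le (pow_nonneg hc n), one_div, Real.pow_rpow_inv_natCast hc hn]

/-- Under (C1)–(C3), let `L̄u(t) = ∫_a^b k⁺(t,s)g(s)u(s)ds` on `C[a,b]`.
If `u ∈ C[a,b]` is strictly positive and `λ > 0` satisfies `λu ≥ L̄u` on `[a,b]`, then
`r(L̄) ≤ λ`. -/
theorem statement15
    (k : ℝ → ℝ → ℝ) (g Φ : ℝ → ℝ) (a b c₁ : ℝ)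
    -- (C1)
    (hC1meas : Measurable (Function.uncurry k))
    (hC1cont : ∀ τ : unitI, ∀ᵐ s ∂μ01,
      Tendsto (fun t : unitI => |k ↑t s - k ↑τ s|) (𝓝 τ) (𝓝 0))
    -- (C2)
    (hc₁0 : 0 < c₁) (hc₁1 : c₁ ≤ 1)
    (hΦint : IntegrableOn Φ unitI)
    (hkup : ∀ t : unitI, ∀ᵐ s ∂μ01, |k ↑t s| ≤ Φ s)
    (hklow : ∀ t : unitI, (t : ℝ) ∈ Set.Icc a b → ∀ᵐ s ∂μ01, c₁ * Φ s ≤ k ↑t s)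
    -- (C3)
    (ha : 0 ≤ a) (hb : b ≤ 1) (hab : a ≤ b)
    (hgmeas : Measurable g) (hgint : IntegrableOn g unitI)
    (hgΦint : IntegrableOn (fun s => g s * Φ s) unitI)
    (hgpos : ∀ᵐ s ∂μ01, 0 ≤ g s)
    (hΦgpos : 0 < ∫ s in Set.Icc a b, Φ s * g s)
    (Lbar : C(Set.Icc a b, ℝ) →L[ℝ] C(Set.Icc a b, ℝ))
    (hLbar : ∀ (u : C(Set.Icc a b, ℝ)) (t : Set.Icc a b),
      Lbar u t = ∫ s in Set.Icc a b, max (k ↑t s) 0 * g s * u (Set.projIcc a b hab s))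
    (r : ℝ) (hr : Tendsto (fun n : ℕ => ‖Lbar ^ n‖ ^ ((1 : ℝ) / n)) atTop (𝓝 r))
    (u : C(Set.Icc a b, ℝ)) (hu : ∀ t, 0 < u t)
    (lam : ℝ) (hlam : 0 < lam) (hle : ∀ t, Lbar u t ≤ lam * u t) :
    r ≤ lam := by
  have : Nonempty (Set.Icc a b) := ⟨⟨a, left_mem_Icc.2 hab⟩⟩
  have hg : ∀ᵐ s ∂volume.restrict (Set.Icc a b), 0 ≤ g s :=
    ae_restrict_of_ae_restrict_of_subset (Set.Icc_subset_Icc ha hb) hgpos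
  have hpos : ∀ w : C(Set.Icc a b, ℝ), 0 ≤ w → 0 ≤ Lbar w := by
    intro w hw t
    change 0 ≤ Lbar w t
    rw [hLbar]
    refine integral_nonneg_of_ae ?_
    filter_upwards [hg] with s hs
    have hws : 0 ≤ w (Set.projIcc a b hab s) := hw _
    exact mul_nonneg (mul_nonneg (le_max_right _ _) hs) hws
  have hLu : Lbar u ≤ lam • u := fun t => hle t
  obtain ⟨C, hC, hbound⟩ :=
    exists_norm_pow_le_mul_pow_of_apply_le Lbar hpos u hu hlam.le hLu
  exact le_of_tendsto_rpow_one_div_of_le_mul_pow (fun n => norm_nonneg (Lbar ^ n)) hC hlam.le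
    hbound hr
end
end
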